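/- Let n, k and r be integers with 1 < r < k < n, and set s = ⌊(rn-1)/k⌋ - 1. Then there exists an (s,k,r)-clash-free permutation of Z_n, i.e., a permutation π of Z_n such that for every subset X ⊆ Z_n of cardinality r+1 with ||X||_n < s we have ||π(X)||_n ≥ k. -/

import Mathlib

/-- `cyclNorm n X` is the minimum length of a cyclic interval of `ZMod n`
containing `X`: the least `t` such that `X ⊆ x + [0,t] (mod n)` for some `x`. -/
noncomputable def cyclNorm (n : ℕ) (X : Set (ZMod n)) : ℕ :=
  sInf {t : ℕ | ∃ x : ZMod n, ∀ y ∈ X, ∃ i : ℕ, i ≤ t ∧ y = x + (i : ZMod n)}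

/-- A permutation `π` of `ZMod n` is `(s,k,r)`-clash-free if there is no
`(r+1)`-subset `X` with `‖X‖ < s` and `‖π(X)‖ < k`. -/
def IsClashFreeR (n s k r : ℕ) (π : Equiv.Perm (ZMod n)) : Prop :=
  ¬ ∃ X : Finset (ZMod n), X.card = r + 1 ∧
      cyclNorm n (X : Set (ZMod n)) < s ∧
      cyclNorm n (⇑π '' (X : Set (ZMod n))) < k

theorem cyclNorm_lt_exists (n k : ℕ) (hn : 0 < n) (X : Set (ZMod n)) (h : cyclNorm n X < k) :
    ∃ x : ZMod n, ∀ y ∈ X, ∃ i : ℕ, i < k ∧ y = x + (i : ZMod n) := by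
  have : NeZero n := ⟨hn.ne'⟩
  have hne : {t : ℕ | ∃ x : ZMod n, ∀ y ∈ X, ∃ i : ℕ, i ≤ t ∧ y = x + (i : ZMod n)}.Nonempty := by
    refine ⟨n, 0, fun y _ => ⟨y.val, (ZMod.val_lt y).le, ?_⟩⟩
    simp
  obtain ⟨x, hx⟩ := Nat.sInf_mem hne
  refine ⟨x, fun y hy => ?_⟩
  obtain ⟨i, hi, e⟩ := hx y hy
  exact ⟨i, lt_of_le_of_lt hi h, e⟩

/-- The lifted sequence. -/
def aSeq (n t m : ℕ) (N : ℕ) : ℤ := (t : ℤ) * N - (((N % n) / m : ℕ) : ℤ)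

theorem aSeq_step (n t m : ℕ) (hm : 0 < m) (N : ℕ) :
    aSeq n t m N + ((t : ℤ) - 1) ≤ aSeq n t m (N + 1) := by
  unfold aSeq
  have h1 : (N + 1) % n ≤ N % n + 1 := by
    rw [Nat.add_mod]
    refine (Nat.mod_le _ _).trans ?_
    have := Nat.mod_le 1 n
    omega
  have h2 : (N + 1) % n / m ≤ N % n / m + 1 := by
    calc (N + 1) % n / m ≤ (N % n + 1) / m := Nat.div_le_div_right h1
      _ ≤ (N % n + m) / m := Nat.div_le_div_right (by omega)
      _ = N % n / m + 1 := Nat.add_div_right _ hm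
  have h3 : (((N + 1) % n / m : ℕ) : ℤ) ≤ ((N % n / m : ℕ) : ℤ) + 1 := by exact_mod_cast h2
  push_cast at h3 ⊢
  linarith

theorem aSeq_low (n t m : ℕ) (hm : 0 < m) (ht : 1 ≤ t) (N l : ℕ) :
    aSeq n t m N + ((t : ℤ) - 1) ≤ aSeq n t m (N + l + 1) := by
  induction l with
  | zero => exact aSeq_step n t m hm N
  | succ l ih =>
    have := aSeq_step n t m hm (N + l + 1)
    have h : (1 : ℤ) ≤ t := by exact_mod_cast ht
    rw [← add_assoc N l 1]
    linarith

theorem aSeq_up (n t m g : ℕ) (hn : 0 < n) (hg : n = g * m) (N l : ℕ) :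
    aSeq n t m (N + l) ≤ aSeq n t m N + (t : ℤ) * l + ((g : ℤ) - 1) := by
  unfold aSeq
  have h1 : N % n / m < g := by
    apply Nat.div_lt_of_lt_mul
    rw [mul_comm m g, ← hg]
    exact Nat.mod_lt _ hn
  have h2 : ((N % n / m : ℕ) : ℤ) + 1 ≤ g := by exact_mod_cast h1
  have h3 : (0 : ℤ) ≤ (((N + l) % n / m : ℕ) : ℤ) := Int.natCast_nonneg _
  push_cast at h2 h3 ⊢
  linarith

theorem aSeq_congr (n t m : ℕ) (N : ℕ) :
    ((aSeq n t m N : ℤ) : ZMod n) = ((aSeq n t m (N % n) : ℤ) : ZMod n) := by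
  unfold aSeq
  push_cast
  simp

theorem aSeq_inj (n t m g u : ℕ) (hm : 0 < m) (hn : 0 < n) (hg : n = g * m) (htu : t = g * u)
    (hc : Nat.Coprime u m) (i j : ℕ) (hi : i < n) (hj : j < n)
    (h : ((aSeq n t m i : ℤ) : ZMod n) = ((aSeq n t m j : ℤ) : ZMod n)) : i = j := by
  have hg0 : 0 < g := by
    rcases Nat.eq_zero_or_pos g with h0 | h0
    · subst h0; simp at hg; omega
    · exact h0
  rw [ZMod.intCast_eq_intCast_iff_dvd_sub] at h
  unfold aSeq at h
  rw [Nat.mod_eq_of_lt hi, Nat.mod_eq_of_lt hj] at h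
  have hi' : i / m < g := Nat.div_lt_of_lt_mul (by rw [mul_comm, ← hg]; exact hi)
  have hj' : j / m < g := Nat.div_lt_of_lt_mul (by rw [mul_comm, ← hg]; exact hj)
  have hi0 : 0 ≤ ((i / m : ℕ) : ℤ) := Int.natCast_nonneg _
  have hj0 : 0 ≤ ((j / m : ℕ) : ℤ) := Int.natCast_nonneg _
  have hi1 : ((i / m : ℕ) : ℤ) < g := by exact_mod_cast hi'
  have hj1 : ((j / m : ℕ) : ℤ) < g := by exact_mod_cast hj'
  have hq : i / m = j / m := by
    have h1 : (g : ℤ) ∣ ((i / m : ℕ) : ℤ) - ((j / m : ℕ) : ℤ) := by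
      have h2 : (g : ℤ) ∣ (t : ℤ) * j - ((j / m : ℕ) : ℤ) - ((t : ℤ) * i - ((i / m : ℕ) : ℤ)) :=
        dvd_trans ⟨(m : ℤ), by rw [hg]; push_cast; ring⟩ h
      have h3 : (g : ℤ) ∣ (t : ℤ) * j - (t : ℤ) * i := ⟨(u : ℤ) * j - u * i, by
        rw [htu]; push_cast; ring⟩
      have h4 := dvd_sub h2 h3
      have e : (t : ℤ) * j - ((j / m : ℕ) : ℤ) - ((t : ℤ) * i - ((i / m : ℕ) : ℤ))
        - ((t : ℤ) * j - (t : ℤ) * i) = ((i / m : ℕ) : ℤ) - ((j / m : ℕ) : ℤ) := by ring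
      rwa [e] at h4
    have h5 := Int.eq_zero_of_abs_lt_dvd h1 (by rw [abs_lt]; constructor <;> linarith)
    exact_mod_cast sub_eq_zero.mp h5
  rw [hq] at h
  have h6 : (g : ℤ) * m ∣ g * (u * ((j : ℤ) - i)) := by
    have e : (t : ℤ) * j - ((j / m : ℕ) : ℤ) - ((t : ℤ) * i - ((j / m : ℕ) : ℤ))
      = g * (u * ((j : ℤ) - i)) := by rw [htu]; push_cast; ring
    rw [e, hg] at h
    exact_mod_cast h
  have h7 := Int.dvd_of_mul_dvd_mul_left (by exact_mod_cast hg0.ne') h6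
  have h8 : (m : ℤ) ∣ (j : ℤ) - i := by
    refine IsCoprime.dvd_of_dvd_mul_left ?_ h7
    exact (Nat.isCoprime_iff_coprime.mpr hc).symm
  have h9 : i % m = j % m := (Nat.modEq_iff_dvd.mpr h8)
  rw [← Nat.div_add_mod i m, ← Nat.div_add_mod j m, hq, h9]

theorem stmt4 (n k r s : ℕ) (hr : 1 < r) (hrk : r < k) (hkn : k < n)
    (hs : s = (r * n - 1) / k - 1) :
    ∃ π : Equiv.Perm (ZMod n),
      ∀ X : Finset (ZMod n), X.card = r + 1 →
        cyclNorm n (X : Set (ZMod n)) < s →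
        k ≤ cyclNorm n (⇑π '' (X : Set (ZMod n))) := by
  have hn : 0 < n := by omega
  have : NeZero n := ⟨hn.ne'⟩
  rcases Nat.eq_zero_or_pos s with h0 | hs0
  · exact ⟨1, fun X _ h => by omega⟩
  obtain ⟨t, ht⟩ : ∃ t, t = (r * n - 1) / k := ⟨_, rfl⟩
  have hts : t = s + 1 := by omega
  have htk : t * k < r * n := by
    have h1 : t * k ≤ r * n - 1 := by rw [ht]; exact Nat.div_mul_le_self _ _
    have h2 : 0 < r * n := by positivity
    omega
  obtain ⟨g, u', m', hg0, hcop, hT, hN⟩ := Nat.exists_coprime' (m := t) (n := n)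
    (Nat.gcd_pos_of_pos_right _ hn)
  rw [mul_comm] at hT hN
  have hm : 0 < m' := by
    rcases Nat.eq_zero_or_pos m' with h0 | h0
    · subst h0; simp at hN; omega
    · exact h0
  -- slack
  have hslack : t * k + g ≤ r * n := by
    have h1 : g * (u' * k) < g * (r * m') := by
      calc g * (u' * k) = t * k := by rw [hT]; ring
        _ < r * n := htk
        _ = g * (r * m') := by rw [hN]; ring
    have h2 : u' * k + 1 ≤ r * m' := Nat.lt_of_mul_lt_mul_left h1
    calc t * k + g = g * (u' * k + 1) := by rw [hT]; ring
      _ ≤ g * (r * m') := Nat.mul_le_mul_left _ h2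
      _ = r * n := by rw [hN]; ring
  let f : ZMod n → ZMod n := fun y => ((aSeq n t m' y.val : ℤ) : ZMod n)
  have hf : Function.Injective f := fun x y hxy =>
    ZMod.val_injective n (aSeq_inj n t m' g u' hm hn hN hT hcop _ _ (ZMod.val_lt x)
      (ZMod.val_lt y) hxy)
  let σ : Equiv.Perm (ZMod n) := Equiv.ofBijective f (Finite.injective_iff_bijective.mp hf)
  refine ⟨σ.symm, fun X hX h1 => ?_⟩
  by_contra h2
  push Not at h2
  obtain ⟨x0, hx0⟩ := cyclNorm_lt_exists n s hn _ h1
  obtain ⟨y0, hy0⟩ := cyclNorm_lt_exists n k hn _ h2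
  have key : ∀ x ∈ X, ∃ i : ℕ, ∃ e : ℕ, ∃ c : ℤ, i < k ∧ e < s ∧ x = x0 + (e : ZMod n) ∧
      σ.symm x = y0 + (i : ZMod n) ∧ aSeq n t m' (y0.val + i) = (x0.val : ℤ) + e + n * c := by
    intro x hx
    obtain ⟨e, he, hxe⟩ := hx0 x hx
    obtain ⟨i, hi, hxi⟩ := hy0 (σ.symm x) ⟨x, hx, rfl⟩
    have h3 : ((aSeq n t m' (y0.val + i) : ℤ) : ZMod n) = (((x0.val : ℤ) + e : ℤ) : ZMod n) := by
      have h4 : σ (σ.symm x) = x := σ.apply_symm_apply x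
      rw [hxi] at h4
      have h5 : (y0 + (i : ZMod n)).val = (y0.val + i) % n := by
        rw [← ZMod.val_natCast]; simp
      have h6 : ((aSeq n t m' (y0 + (i : ZMod n)).val : ℤ) : ZMod n) = x := h4
      rw [h5, ← aSeq_congr] at h6
      rw [h6, hxe]
      simp
    rw [eq_comm, ZMod.intCast_eq_intCast_iff_dvd_sub] at h3
    obtain ⟨c, hc⟩ := h3
    exact ⟨i, e, c, hi, he, hxe, hxi, by linarith⟩
  choose! I E C hI hE hxE hxI hA using key
  have tZ : (t : ℤ) = s + 1 := by exact_mod_cast hts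
  have slackZ : (t : ℤ) * k + g ≤ r * n := by exact_mod_cast hslack
  have nZ : (0 : ℤ) < n := by exact_mod_cast hn
  have hlow : ∀ x ∈ X, ∀ y ∈ X, I x < I y → C x < C y := by
    intro x hx y hy hlt
    have h3 := aSeq_low n t m' hm (by omega) (y0.val + I x) (I y - I x - 1)
    rw [show y0.val + I x + (I y - I x - 1) + 1 = y0.val + I y by omega, hA x hx, hA y hy] at h3
    have h4 := hE y hy
    have h5 : (E y : ℤ) < s := by exact_mod_cast h4
    have h6 : (0 : ℤ) ≤ E x := by positivity
    have h7 : (n : ℤ) * C x < n * C y := by linarith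
    exact lt_of_mul_lt_mul_left h7 nZ.le
  have hup : ∀ x ∈ X, ∀ y ∈ X, C y < C x + r := by
    intro x hx y hy
    rcases le_or_gt (I x) (I y) with hle | hgt
    · have h3 := aSeq_up n t m' g hn hN (y0.val + I x) (I y - I x)
      rw [show y0.val + I x + (I y - I x) = y0.val + I y by omega, hA x hx, hA y hy] at h3
      have h4 : (E x : ℤ) < s := by exact_mod_cast hE x hx
      have h6 : (0 : ℤ) ≤ E y := by positivity
      have h8 : ((I y - I x : ℕ) : ℤ) ≤ k - 1 := by have := hI y hy; omega
      have h9 : (t : ℤ) * ((I y - I x : ℕ) : ℤ) ≤ t * (k - 1) :=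
        mul_le_mul_of_nonneg_left h8 (by positivity)
      have h7 : (n : ℤ) * C y < n * (C x + r) := by linarith
      exact lt_of_mul_lt_mul_left h7 nZ.le
    · have := hlow y hy x hx hgt
      omega
  have hinj : Set.InjOn C (X : Set (ZMod n)) := by
    intro x hx y hy hxy
    rcases lt_trichotomy (I x) (I y) with h | h | h
    · have := hlow x hx y hy h; omega
    · apply σ.symm.injective
      rw [hxI x hx, hxI y hy, h]
    · have := hlow y hy x hx h; omega
  have hXne : X.Nonempty := Finset.card_pos.mp (by omega)
  obtain ⟨z, hz, hzmin⟩ := Finset.exists_min_image X C hXne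
  have hsub : X.image C ⊆ Finset.Ico (C z) (C z + r) := by
    intro c hc
    obtain ⟨x, hx, rfl⟩ := Finset.mem_image.mp hc
    exact Finset.mem_Ico.mpr ⟨hzmin x hx, hup z hz x hx⟩
  have hcard := Finset.card_le_card hsub
  rw [Finset.card_image_of_injOn hinj, Int.card_Ico] at hcard
  omega
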